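/- Suppose α ∈ S_k + U_i for some k ∈ ℕ and i ∈ ℕ₀, and let m = max(k, m_i). Then there exists (L,N) ∈ ℕ₀^m × ℕ₀^i such that (L,N) is irreducible with respect to 𝒯 and α = |(L,N)|. -/

import Mathlib

/-! Core combinatorial definitions for the jumping-polynomial construction. -/

namespace Jump

/-- Tuples of nonnegative integers, indexed by positive integers (index 0 unused). -/
abbrev Vec := ℕ → ℕ

/-- Pairs of tuples. -/
abbrev PVec := Vec × Vec

/-- `A` is a tuple in `ℕ₀^k` (entries indexed by `1, …, k`). -/
def Supp (k : ℕ) (A : Vec) : Prop := ∀ j : ℕ, (j = 0 ∨ k < j) → A j = 0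

/-- `A` is a tuple in `ℤ^k` (entries indexed by `1, …, k`). -/
def SuppZ (k : ℕ) (A : ℕ → ℤ) : Prop := ∀ j : ℕ, (j = 0 ∨ k < j) → A j = 0

/-- `(A, C)` is irreducible with respect to a set `T` of pairs of tuples: no member of `T`
is componentwise less than or equal to `(A, C)`. -/
def Irr (T : Set PVec) (p : PVec) : Prop := ∀ bd ∈ T, ¬ (bd.1 ≤ p.1 ∧ bd.2 ≤ p.2)

/-- The weight `A·β(k) = a₁β₁ + ⋯ + a_kβ_k` of a tuple of nonnegative integers. -/
noncomputable def wtA (β : ℕ → ℝ) (k : ℕ) (A : Vec) : ℝ :=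
  ∑ j ∈ Finset.Icc 1 k, (A j : ℝ) * β j

/-- The weight of a tuple of integers. -/
noncomputable def wtZ (β : ℕ → ℝ) (k : ℕ) (A : ℕ → ℤ) : ℝ :=
  ∑ j ∈ Finset.Icc 1 k, (A j : ℝ) * β j

/-- The weight `|(A, C)| = A·β(k) + C·γ(i)` of a pair of tuples. -/
noncomputable def wt (β γ : ℕ → ℝ) (k i : ℕ) (p : PVec) : ℝ :=
  wtA β k p.1 + wtA γ i p.2

/-- The group `G_n = β₁ℤ + ⋯ + β_nℤ` (as a subset of `ℝ`; `G_0 = {0}`). -/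
noncomputable def Gr (β : ℕ → ℝ) (n : ℕ) : Set ℝ :=
  {t | ∃ A : ℕ → ℤ, SuppZ n A ∧ t = wtZ β n A}

/-- The semigroup `S_n = β₁ℕ₀ + ⋯ + β_nℕ₀` (as a subset of `ℝ`; `S_0 = {0}`). -/
noncomputable def Sg (β : ℕ → ℝ) (n : ℕ) : Set ℝ :=
  {t | ∃ A : Vec, Supp n A ∧ t = wtA β n A}

/-- The set `G_k + H_i`. -/
noncomputable def GrH (β γ : ℕ → ℝ) (k i : ℕ) : Set ℝ :=
  {t | ∃ a ∈ Gr β k, ∃ b ∈ Gr γ i, t = a + b}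

/-- The set `G + H_i`, where `G = ⋃_{n ≤ len} G_n`. -/
noncomputable def GH (β γ : ℕ → ℝ) (len : ℕ∞) (i : ℕ) : Set ℝ :=
  {t | ∃ k : ℕ, (k : ℕ∞) ≤ len ∧ t ∈ GrH β γ k i}

/-- The set `S_k + U_i`. -/
noncomputable def SU (β γ : ℕ → ℝ) (k i : ℕ) : Set ℝ :=
  {t | ∃ a ∈ Sg β k, ∃ b ∈ Sg γ i, t = a + b}

/-- The `j`-th standard basis vector `E_j`. -/
def unitVec (j : ℕ) : Vec := fun l => if l = j then 1 else 0

/-- The set `𝒫 = {(q_jE_j, 0̄) : j ≥ 2, q_j < ∞}`. -/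
def Pset (q : ℕ → ℕ∞) : Set PVec :=
  {p | ∃ j : ℕ, 2 ≤ j ∧ ∃ t : ℕ, q j = (t : ℕ∞) ∧
        p = (fun l => t * unitVec j l, fun _ => 0)}

/-- `(A, C) ∈ ℕ₀^{m_i} × ℕ₀^i` pushes `γ_i`: `c_i > 0` and `|(A, C)| ∈ S_{m_i} + U_{i-1}`. -/
noncomputable def Push (β γ : ℕ → ℝ) (mi i : ℕ) (p : PVec) : Prop :=
  0 < p.2 i ∧ wt β γ mi i p ∈ SU β γ mi (i - 1)

/-- `(A, C)` is reduced: it pushes `γ_i` and no pair strictly below it (componentwise) does. -/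
noncomputable def Red (β γ : ℕ → ℝ) (mi i : ℕ) (p : PVec) : Prop :=
  Push β γ mi i p ∧
    ∀ p' : PVec, p'.1 ≤ p.1 → p'.2 ≤ p.2 → p' ≠ p → ¬ Push β γ mi i p'

/-- The set `𝒟_i`, built from `𝒯_i`: empty if `s_i = ∞`, otherwise the pairs in
`ℕ₀^{m_i} × ℕ₀^i` that are irreducible with respect to `𝒯_i` and reduced. -/
noncomputable def Dstep (β γ : ℕ → ℝ) (s : ℕ → ℕ∞) (m : ℕ → ℕ) (i : ℕ)
    (Ti : Set PVec) : Set PVec :=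
  if s i = ⊤ then ∅ else
    {p | Supp (m i) p.1 ∧ Supp i p.2 ∧ Irr Ti p ∧ Red β γ (m i) i p}

/-- The chain `𝒯_1 = 𝒫`, `𝒯_{i+1} = 𝒯_i ∪ 𝒟_i` (here `Tchain 0 = Tchain 1 = 𝒫`,
which is forced by the convention `s 0 = ⊤`). -/
noncomputable def Tchain (β γ : ℕ → ℝ) (q s : ℕ → ℕ∞) (m : ℕ → ℕ) : ℕ → Set PVec
  | 0 => Pset q
  | n + 1 => Tchain β γ q s m n ∪ Dstep β γ s m n (Tchain β γ q s m n)

/-- The set `𝒯 = ⋃_i 𝒯_i`. -/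
noncomputable def Tfull (β γ : ℕ → ℝ) (q s : ℕ → ℕ∞) (m : ℕ → ℕ) : Set PVec :=
  ⋃ n, Tchain β γ q s m n

/-- A tuple `A ∈ ℤ^k` is permissible: `0 ≤ a_j < q_j` for all `1 ≤ j ≤ k` with `q_j < ∞`. -/
def PermZ (q : ℕ → ℕ∞) (k : ℕ) (A : ℕ → ℤ) : Prop :=
  ∀ j : ℕ, 1 ≤ j → j ≤ k → ∀ t : ℕ, q j = (t : ℕ∞) → 0 ≤ A j ∧ A j < (t : ℤ)

/-- A tuple `A ∈ ℕ₀^k` is permissible: `a_j < q_j` for all `1 ≤ j ≤ k` with `q_j < ∞`. -/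
def PermN (q : ℕ → ℕ∞) (k : ℕ) (A : Vec) : Prop :=
  ∀ j : ℕ, 1 ≤ j → j ≤ k → ∀ t : ℕ, q j = (t : ℕ∞) → A j < t

/-- The abstract combinatorial setup of the jumping-polynomial construction:
a finite (of length `len`) or infinite (`len = ⊤`) sequence `β` of positive reals,
a sequence `γ` of nonnegative reals, and the derived data `q_j`, `s_i`, `m_i`
defined by their minimality properties. -/
structure Setup where
  /-- the length of the `β`-sequence (possibly `∞`) -/
  len : ℕ∞
  β : ℕ → ℝ
  γ : ℕ → ℝ
  q : ℕ → ℕ∞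
  s : ℕ → ℕ∞
  m : ℕ → ℕ
  hlen : 2 ≤ len
  hβ : ∀ j : ℕ, 1 ≤ j → (j : ℕ∞) ≤ len → 0 < β j
  hγ : ∀ i : ℕ, 1 ≤ i → 0 ≤ γ i
  hq1 : q 1 = ⊤
  hqtop : ∀ j : ℕ, len < (j : ℕ∞) → q j = ⊤
  hq : ∀ j : ℕ, 2 ≤ j → (j : ℕ∞) ≤ len →
    q j = sInf {x : ℕ∞ | ∃ t : ℕ, x = (t : ℕ∞) ∧ 0 < t ∧ (t : ℝ) * β j ∈ Gr β (j - 1)}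
  /-- if `q_j = ∞` then `β_j` is the last term of the `β`-sequence, and conversely -/
  hlast : ∀ j : ℕ, 2 ≤ j → (j : ℕ∞) ≤ len → (q j = ⊤ ↔ len = (j : ℕ∞))
  /-- `β_{j+1} > q_jβ_j` whenever `q_j < ∞` -/
  hgrow : ∀ j : ℕ, 2 ≤ j → (j : ℕ∞) ≤ len → ∀ t : ℕ, q j = (t : ℕ∞) →
    (t : ℝ) * β j < β (j + 1)
  hs0 : s 0 = ⊤
  hs : ∀ i : ℕ, 1 ≤ i →
    s i = sInf {x : ℕ∞ | ∃ t : ℕ, x = (t : ℕ∞) ∧ 0 < t ∧ (t : ℝ) * γ i ∈ GH β γ len (i - 1)}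
  hm0 : m 0 = 1
  hmtop : ∀ i : ℕ, 1 ≤ i → s i = ⊤ → m i = m (i - 1)
  hmfin : ∀ i : ℕ, 1 ≤ i → ∀ t : ℕ, s i = (t : ℕ∞) →
    m i = max (m (i - 1))
      (sInf {j : ℕ | 1 ≤ j ∧ (j : ℕ∞) ≤ len ∧ (t : ℝ) * γ i ∈ GrH β γ j (i - 1)})
  hmlen : ∀ i : ℕ, 1 ≤ m i ∧ ((m i : ℕ) : ℕ∞) ≤ len

end Jump

namespace Jump

lemma wtA_add (β : ℕ → ℝ) (k : ℕ) (A B : Vec) : wtA β k (A + B) = wtA β k A + wtA β k B := by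
  simp [wtA, add_mul, Finset.sum_add_distrib]

lemma wtA_eq_of_supp (β : ℕ → ℝ) {k n : ℕ} (hkn : k ≤ n) {A : Vec} (hA : Supp k A) :
    wtA β n A = wtA β k A := by
  refine (Finset.sum_subset (Finset.Icc_subset_Icc_right hkn) fun j hj hj' => ?_).symm
  have : k < j := by simp only [Finset.mem_Icc] at hj hj'; omega
  simp [hA j (Or.inr this)]

lemma wtA_smul_unitVec (β : ℕ → ℝ) {n j : ℕ} (h1 : 1 ≤ j) (hn : j ≤ n) (t : ℕ) :
    wtA β n (fun l => t * unitVec j l) = t * β j := by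
  rw [wtA, Finset.sum_eq_single_of_mem j (Finset.mem_Icc.2 ⟨h1, hn⟩)]
  · simp [unitVec]
  · intro b _ hb
    simp [unitVec, hb]

lemma Supp.mono {k n : ℕ} (hkn : k ≤ n) {A : Vec} (hA : Supp k A) : Supp n A :=
  fun j hj => hA j (hj.imp_right fun h => hkn.trans_lt h)

lemma Supp.add {n : ℕ} {A B : Vec} (hA : Supp n A) (hB : Supp n B) : Supp n (A + B) :=
  fun j hj => by simp [hA j hj, hB j hj]

lemma Supp.sub {n : ℕ} {A : Vec} (hA : Supp n A) (B : Vec) : Supp n (A - B) :=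
  fun j hj => by simp [hA j hj]

/-- Replacing a part `B` of `A` by a tuple `B'` changes the weight accordingly. -/
lemma wtA_replace (β : ℕ → ℝ) (n : ℕ) {A B : Vec} (hBA : B ≤ A) (B' : Vec) :
    wtA β n (A - B + B') = wtA β n A - wtA β n B + wtA β n B' := by
  have h := wtA_add β n (A - B) B
  rw [tsub_add_cancel_of_le hBA] at h
  rw [wtA_add, h]
  ring

lemma Gr_add_zsmul {β : ℕ → ℝ} {n : ℕ} {x y : ℝ} (hx : x ∈ Gr β n) (hy : y ∈ Gr β n) (e : ℤ) :
    x + e * y ∈ Gr β n := by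
  obtain ⟨A, hA, rfl⟩ := hx
  obtain ⟨B, hB, rfl⟩ := hy
  refine ⟨fun l => A l + e * B l, fun j hj => by simp [hA j hj, hB j hj], ?_⟩
  simp [wtZ, add_mul, Finset.sum_add_distrib, Finset.mul_sum, mul_assoc]

lemma exists_of_mem_Gr_succ {β : ℕ → ℝ} {n : ℕ} {x : ℝ} (hx : x ∈ Gr β (n + 1)) :
    ∃ y ∈ Gr β n, ∃ a : ℤ, x = y + a * β (n + 1) := by
  obtain ⟨A, hA, rfl⟩ := hx
  refine ⟨_, ⟨fun l => if l = n + 1 then 0 else A l, fun j hj => ?_, rfl⟩, A (n + 1), ?_⟩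
  · dsimp only
    split_ifs with h
    · rfl
    · exact hA j (by omega)
  · rw [wtZ, Finset.sum_Icc_succ_top (by omega), wtZ]
    congr 1
    refine Finset.sum_congr rfl fun j hj => ?_
    rw [if_neg (by simp only [Finset.mem_Icc] at hj; omega)]

lemma Sg_add_mul {β : ℕ → ℝ} {n : ℕ} {y : ℝ} (hy : y ∈ Sg β n) (a : ℕ) :
    y + a * β (n + 1) ∈ Sg β (n + 1) := by
  obtain ⟨A, hA, rfl⟩ := hy
  refine ⟨A + fun l => a * unitVec (n + 1) l, (hA.mono n.le_succ).add fun j hj => ?_, ?_⟩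
  · have : j ≠ n + 1 := by omega
    simp [unitVec, this]
  · rw [wtA_add, wtA_smul_unitVec β (by omega) le_rfl, wtA_eq_of_supp β n.le_succ hA]

lemma sInf_coe_mem {P : ℕ → Prop} {t : ℕ}
    (h : (t : ℕ∞) = sInf {x : ℕ∞ | ∃ u : ℕ, x = (u : ℕ∞) ∧ P u}) : P t := by
  have hne : {x : ℕ∞ | ∃ u : ℕ, x = (u : ℕ∞) ∧ P u}.Nonempty := by
    by_contra hne
    rw [Set.not_nonempty_iff_eq_empty.1 hne, sInf_empty] at h
    exact ENat.natCast_ne_top t h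
  obtain ⟨u, hu, hP⟩ := csInf_mem hne
  rw [← h] at hu
  rwa [Nat.cast_inj.1 hu]

lemma q_spec (d : Setup) {j t : ℕ} (hj : 2 ≤ j) (hjl : (j : ℕ∞) ≤ d.len)
    (ht : d.q j = (t : ℕ∞)) : 0 < t ∧ (t : ℝ) * d.β j ∈ Gr d.β (j - 1) :=
  sInf_coe_mem (ht.symm.trans (d.hq j hj hjl))

/-- Elements of `G_n` that are at least `β_{n+1}` lie in `S_n`. -/
lemma mem_Sg_of_mem_Gr (d : Setup) (n : ℕ) (hn : 1 ≤ n) :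
    ((n + 1 : ℕ) : ℕ∞) ≤ d.len → ∀ x ∈ Gr d.β n, d.β (n + 1) ≤ x → x ∈ Sg d.β n := by
  induction n, hn using Nat.le_induction with
  | base =>
    intro hl x hx hle
    obtain ⟨y, ⟨A, -, rfl⟩, a, rfl⟩ := exists_of_mem_Gr_succ hx
    have h1 : 0 < d.β 1 := d.hβ 1 le_rfl (le_trans (by norm_num) hl)
    have h2 : 0 < d.β 2 := d.hβ 2 (by norm_num) hl
    have hz : wtZ d.β 0 A = 0 := by simp [wtZ]
    have ha : 0 ≤ a := by
      by_contra! hlt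
      have : (a : ℝ) < 0 := by exact_mod_cast hlt
      norm_num [hz] at hle
      nlinarith
    lift a to ℕ using ha
    rw [hz]
    exact_mod_cast Sg_add_mul (β := d.β) (n := 0) (y := 0)
      ⟨fun _ => 0, fun _ _ => rfl, by simp [wtA]⟩ a
  | succ n hn ih =>
    intro hl x hx hle
    have hl' : ((n + 1 : ℕ) : ℕ∞) ≤ d.len := le_trans (by exact_mod_cast Nat.le_succ _) hl
    have hb : 0 < d.β (n + 1) := d.hβ _ (by omega) hl'
    have hq : d.q (n + 1) ≠ ⊤ := fun h => by
      rw [(d.hlast (n + 1) (by omega) hl').1 h] at hl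
      have : n + 1 + 1 ≤ n + 1 := by exact_mod_cast hl
      omega
    obtain ⟨t, ht⟩ := ENat.ne_top_iff_exists.1 hq
    obtain ⟨ht0, htG⟩ := q_spec d (by omega) hl' ht.symm
    have hgrow := d.hgrow (n + 1) (by omega) hl' t ht.symm
    obtain ⟨y, hy, a, rfl⟩ := exists_of_mem_Gr_succ hx
    have ht0' : (0 : ℤ) < t := by exact_mod_cast ht0
    have hrt : a % (t : ℤ) + 1 ≤ t := Int.emod_lt_of_pos a ht0'
    have hdiv := Int.emod_add_mul_ediv a t
    obtain ⟨r, hr⟩ := Int.eq_ofNat_of_zero_le (Int.emod_nonneg a ht0'.ne')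
    rw [hr] at hdiv hrt
    have hrt' : (r : ℝ) + 1 ≤ t := by exact_mod_cast hrt
    have ha : (a : ℝ) = r + t * ((a / (t : ℤ) : ℤ) : ℝ) := by exact_mod_cast hdiv.symm
    have hsplit : y + a * d.β (n + 1) =
        y + ((a / (t : ℤ) : ℤ) : ℝ) * (t * d.β (n + 1)) + r * d.β (n + 1) := by
      rw [ha]
      ring
    rw [hsplit] at hle ⊢
    refine Sg_add_mul (ih hl' _ (Gr_add_zsmul hy htG _) ?_) r
    have := mul_le_mul_of_nonneg_right hrt' hb.le
    linarith

/-- A nonempty family of tuples agreeing from index `n` on has a member that is minimal in the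
lexicographic order comparing the highest indices first. -/
lemma exists_lex_min (n : ℕ) : ∀ P : Vec → Prop, (∃ A, P A) →
    (∀ A A', P A → P A' → ∀ l, n ≤ l → A l = A' l) →
    ∃ A, P A ∧ ∀ A', P A' → ∀ j, (∀ l, j < l → A' l = A l) → A j ≤ A' j := by
  induction n with
  | zero =>
    rintro P ⟨A, hA⟩ hagree
    exact ⟨A, hA, fun A' hA' j _ => (hagree A A' hA hA' j (Nat.zero_le j)).le⟩
  | succ n ih =>
    rintro P ⟨A₀, hA₀⟩ hagree
    classical
    have hex : ∃ v, ∃ A, P A ∧ A n = v := ⟨_, A₀, hA₀, rfl⟩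
    obtain ⟨A₁, hA₁, hv⟩ := Nat.find_spec hex
    obtain ⟨A, ⟨hA, hAn⟩, hmin⟩ := ih (fun A => P A ∧ A n = Nat.find hex) ⟨A₁, hA₁, hv⟩
      fun A A' h h' l hl => by
        rcases hl.eq_or_lt with rfl | hl
        · rw [h.2, h'.2]
        · exact hagree A A' h.1 h'.1 l hl
    refine ⟨A, hA, fun A' hA' j hj => ?_⟩
    rcases lt_trichotomy j n with h | rfl | h
    · exact hmin A' ⟨hA', (hj n h).trans hAn⟩ j hj
    · exact hAn ▸ Nat.find_min' hex ⟨A', hA', rfl⟩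
    · exact (hagree A A' hA hA' j h).le

lemma exists_lex_min_of_supp {n : ℕ} {P : Vec → Prop} (hne : ∃ A, P A)
    (hP : ∀ A, P A → Supp n A) :
    ∃ A, P A ∧ ∀ A', P A' → ∀ j, (∀ l, j < l → A' l = A l) → A j ≤ A' j :=
  exists_lex_min (n + 1) P hne fun A A' h h' l hl => by
    rw [hP A h l (Or.inr hl), hP A' h' l (Or.inr hl)]

lemma mem_Tchain {β γ : ℕ → ℝ} {q s : ℕ → ℕ∞} {m : ℕ → ℕ} {p : PVec} (n : ℕ)
    (hp : p ∈ Tchain β γ q s m n) :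
    p ∈ Pset q ∨ ∃ t, s t ≠ ⊤ ∧ Supp (m t) p.1 ∧ Supp t p.2 ∧ Push β γ (m t) t p := by
  induction n with
  | zero => exact Or.inl hp
  | succ n ih =>
    rcases hp with hp | hp
    · exact ih hp
    · unfold Dstep at hp
      split_ifs at hp with h
      · exact hp.elim
      · exact Or.inr ⟨n, h, hp.1, hp.2.1, hp.2.2.2.1⟩

lemma m_mono (d : Setup) : Monotone d.m := by
  refine monotone_nat_of_le_succ fun n => ?_
  by_cases h : d.s (n + 1) = ⊤
  · exact (d.hmtop (n + 1) (by omega) h).ge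
  · obtain ⟨t, ht⟩ := ENat.ne_top_iff_exists.1 h
    rw [d.hmfin (n + 1) (by omega) t ht.symm]
    exact le_max_left _ _

/-- For `q_j < ∞` the element `q_jβ_j` lies in `S_{j-1}`. -/
lemma q_mul_mem_Sg (d : Setup) {j t : ℕ} (hj : 2 ≤ j) (ht : d.q j = (t : ℕ∞)) :
    0 < t ∧ (t : ℝ) * d.β j ∈ Sg d.β (j - 1) := by
  have hjl : (j : ℕ∞) ≤ d.len := by
    by_contra! h
    exact ENat.natCast_ne_top t (ht ▸ d.hqtop j h)
  obtain ⟨ht0, htG⟩ := q_spec d hj hjl ht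
  obtain ⟨n, rfl⟩ : ∃ n, j = n + 1 := ⟨j - 1, by omega⟩
  have hb : 0 < d.β (n + 1) := d.hβ _ (by omega) hjl
  refine ⟨ht0, mem_Sg_of_mem_Gr d n (by omega) hjl _ htG ?_⟩
  exact le_mul_of_one_le_left hb.le (by exact_mod_cast ht0)

/-- Lemma: semigroup representation. If `α ∈ S_k + U_i` and
`m = max(k, m_i)`, then there is `(L, N) ∈ ℕ₀^m × ℕ₀^i` irreducible with respect to `𝒯`
such that `α = |(L, N)|`. -/
theorem semigroup_representation (d : Setup) (k i : ℕ) (hk : 1 ≤ k)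
    (hkl : (k : ℕ∞) ≤ d.len) (α : ℝ) (hα : α ∈ SU d.β d.γ k i) :
    ∃ L N : Vec, Supp (max k (d.m i)) L ∧ Supp i N ∧
      Irr (Tfull d.β d.γ d.q d.s d.m) (L, N) ∧
      α = wt d.β d.γ (max k (d.m i)) i (L, N) := by
  set M := max k (d.m i)
  obtain ⟨_, ⟨A₀, hA₀, rfl⟩, _, ⟨C₀, hC₀, rfl⟩, rfl⟩ := hα
  set α := wtA d.β k A₀ + wtA d.γ i C₀ with hα
  rw [← wtA_eq_of_supp d.β (le_max_left k (d.m i)) hA₀] at hα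
  obtain ⟨N, ⟨hN, A₁, hA₁, hw₁⟩, hNmin⟩ := exists_lex_min_of_supp (n := i)
    (P := fun C => Supp i C ∧ ∃ A, Supp M A ∧ α = wtA d.β M A + wtA d.γ i C)
    ⟨C₀, hC₀, A₀, hA₀.mono (le_max_left _ _), hα⟩ fun _ h => h.1
  obtain ⟨L, ⟨hL, hw⟩, hLmin⟩ := exists_lex_min_of_supp (n := M)
    (P := fun A => Supp M A ∧ α = wtA d.β M A + wtA d.γ i N) ⟨A₁, hA₁, hw₁⟩ fun _ h => h.1
  refine ⟨L, N, hL, hN, ?_, hw⟩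
  rintro ⟨B, D⟩ hp ⟨hBL, hDN⟩
  obtain ⟨n, hn⟩ := Set.mem_iUnion.1 hp
  rcases mem_Tchain n hn with ⟨j, hj, t, ht, hBD⟩ | ⟨t, hst, hB, hD, hpos, hpush⟩
  · obtain ⟨rfl, rfl⟩ := Prod.ext_iff.1 hBD
    obtain ⟨ht0, B', hB', hwB⟩ := q_mul_mem_Sg d hj ht
    have hLj : t ≤ L j := by simpa [unitVec] using hBL j
    have hjM : j ≤ M := by
      by_contra! h
      have := hL j (Or.inr h)
      omega
    have hjM' : j - 1 ≤ M := by omega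
    have key := hLmin (L - (fun l => t * unitVec j l) + B')
      ⟨(hL.sub _).add (hB'.mono hjM'), by
        rw [wtA_replace d.β M hBL, wtA_smul_unitVec d.β (by omega) hjM, hwB,
          wtA_eq_of_supp d.β hjM' hB', sub_add_cancel]
        exact hw⟩ j fun l hl => by
        simp [unitVec, hl.ne', hB' l (Or.inr (by omega))]
    simp [unitVec, hB' j (Or.inr (by omega))] at key
    omega
  · have ht0 : t ≠ 0 := fun h => hst (h ▸ d.hs0)
    simp only at hB hD hpos hpush hBL hDN
    have hNt : D t ≤ N t := hDN t
    have hti : t ≤ i := by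
      by_contra! h
      have := hN t (Or.inr h)
      omega
    have hmM : d.m t ≤ M := (m_mono d hti).trans (le_max_right _ _)
    have hti' : t - 1 ≤ i := by omega
    obtain ⟨_, ⟨B', hB', rfl⟩, _, ⟨D', hD', rfl⟩, hwBD⟩ := hpush
    rw [wt, ← wtA_eq_of_supp d.β hmM hB, ← wtA_eq_of_supp d.γ hti hD,
      ← wtA_eq_of_supp d.β hmM hB', ← wtA_eq_of_supp d.γ hti' hD'] at hwBD
    have key := hNmin (N - D + D')
      ⟨(hN.sub _).add (hD'.mono hti'), L - B + B', (hL.sub _).add (hB'.mono hmM), by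
        rw [wtA_replace d.β M hBL, wtA_replace d.γ i hDN]
        linarith⟩ t fun l hl => by
        simp [hD l (Or.inr hl), hD' l (Or.inr (by omega))]
    simp [hD' t (Or.inr (by omega))] at key
    omega

end Jump
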